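/- arXiv:1008.0190 — 2 statements merged into one kernel-verified Lean document; each statement's English description precedes it below -/
import Mathlib

section
/- Let Λ = ℤσ ⊕ ℤf be the rank-two lattice with symmetric bilinear form determined by σ·σ = 0, σ·f = 1, f·f = 0. Fix an integer m ≥ 1 and an integer l with l ≥ m, and set H := σ + l·f. Then for every element D = aσ + bf of Λ satisfying −m ≤ D·D < 0, the integers D·H and D·f are both nonzero and have the same sign (both positive or both negative). -/
/-- The symmetric bilinear form on Λ = ℤσ ⊕ ℤf determined by
σ·σ = 0, σ·f = 1, f·f = 0, where an element x₁σ + x₂f is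
represented by the pair (x₁, x₂) ∈ ℤ × ℤ. -/
def abelianForm (x y : ℤ × ℤ) : ℤ := x.1 * y.2 + x.2 * y.1

/-- On Λ = ℤσ ⊕ ℤf with σ·σ = 0, σ·f = 1, f·f = 0, fix m ≥ 1 and l ≥ m and
set H := σ + l·f.  Then for every D = aσ + bf with −m ≤ D·D < 0, the integers
D·H and D·f are both nonzero and have the same sign. -/
theorem stmt_0 (m l : ℤ) (hm : 1 ≤ m) (hl : m ≤ l)
    (a b : ℤ)
    (hD₁ : -m ≤ abelianForm (a, b) (a, b))
    (hD₂ : abelianForm (a, b) (a, b) < 0) :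
    (abelianForm (a, b) (1, l) ≠ 0 ∧ abelianForm (a, b) (0, 1) ≠ 0) ∧
      ((0 < abelianForm (a, b) (1, l) ∧ 0 < abelianForm (a, b) (0, 1)) ∨
        (abelianForm (a, b) (1, l) < 0 ∧ abelianForm (a, b) (0, 1) < 0)) := by
  simp only [abelianForm, mul_one, mul_zero, add_zero] at *
  have hab : a * b < 0 := by linarith
  rcases mul_neg_iff.mp hab with ⟨ha, hb⟩ | ⟨ha, hb⟩
  · have hH : 0 < a * l + b := by nlinarith
    exact ⟨⟨hH.ne', ha.ne'⟩, Or.inl ⟨hH, ha⟩⟩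
  · have hH : a * l + b < 0 := by nlinarith
    exact ⟨⟨hH.ne, ha.ne⟩, Or.inr ⟨hH, ha⟩⟩
end

section
/- Let Λ = ℤσ ⊕ ℤf be the rank-two lattice with symmetric bilinear form determined by σ·σ = −2, σ·f = 1, f·f = 0. Fix an integer m ≥ 1 and an integer l with l ≥ m + 1, and set H := σ + l·f. Then for every element D = aσ + bf of Λ satisfying −m ≤ D·D < 0, the integers D·H and D·f are both nonzero and have the same sign (both positive or both negative). -/
/-- The symmetric bilinear form on Λ = ℤσ ⊕ ℤf determined by
σ·σ = −2, σ·f = 1, f·f = 0, where an element x₁σ + x₂f is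
represented by the pair (x₁, x₂) ∈ ℤ × ℤ. -/
def k3Form (x y : ℤ × ℤ) : ℤ := -2 * (x.1 * y.1) + x.1 * y.2 + x.2 * y.1

/-- On Λ = ℤσ ⊕ ℤf with σ·σ = −2, σ·f = 1, f·f = 0, fix m ≥ 1 and l ≥ m + 1
and set H := σ + l·f.  Then for every D = aσ + bf with −m ≤ D·D < 0, the
integers D·H and D·f are both nonzero and have the same sign. -/
theorem stmt_1 (m l : ℤ) (hm : 1 ≤ m) (hl : m + 1 ≤ l)
    (a b : ℤ)
    (hD₁ : -m ≤ k3Form (a, b) (a, b))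
    (hD₂ : k3Form (a, b) (a, b) < 0) :
    (k3Form (a, b) (1, l) ≠ 0 ∧ k3Form (a, b) (0, 1) ≠ 0) ∧
      ((0 < k3Form (a, b) (1, l) ∧ 0 < k3Form (a, b) (0, 1)) ∨
        (k3Form (a, b) (1, l) < 0 ∧ k3Form (a, b) (0, 1) < 0)) := by
  simp only [k3Form] at *
  have ha : a ≠ 0 := by
    rintro rfl
    simp at hD₂
  have ha₂ : 1 ≤ a * a := mul_self_pos.mpr ha
  have hle : m ≤ a * a * (l - 1) := by nlinarith
  have hpos : 0 < (-2 * (a * 1) + a * l + b * 1) * (-2 * (a * 0) + a * 1 + b * 0) := by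
    nlinarith
  exact ⟨⟨left_ne_zero_of_mul hpos.ne', right_ne_zero_of_mul hpos.ne'⟩, mul_pos_iff.mp hpos⟩
end
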